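/- arXiv:2309.16348 — 2 statements merged into one kernel-verified Lean document; each statement's English description precedes it below -/
import Mathlib

section
/- For every positive integer m, ∫_ℝ |ρ_m′(u) − ψ(u)| f(u) du ≤ (C/m) · (∫_ℝ |x| φ(x) dx) · (∫_ℝ |f′(u)| du). In particular, if e is a random variable with density f, then E|ρ_m′(e) − ψ(e)| = O(m^{−1}) as m → ∞. -/
open MeasureTheory Filter

/-- The regular (smoothing) sequence `ρ_m(u) = ∫ ρ(x) φ_m(x - u) dx` with
`φ_m(v) = m · φ(m · v)`. -/
noncomputable def regSeq (ρ φ : ℝ → ℝ) (m : ℕ) (u : ℝ) : ℝ :=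
  ∫ x : ℝ, ρ x * ((m : ℝ) * φ ((m : ℝ) * (x - u)))

/-- The mean `L¹` translation estimate for a `C¹` function with integrable derivative. -/
theorem integral_abs_translate_sub_le {f : ℝ → ℝ} (hf : ContDiff ℝ 1 f)
    (hf' : Integrable (deriv f)) (h : ℝ) :
    ∫ u : ℝ, |f (u - h) - f u| ≤ |h| * ∫ u : ℝ, |deriv f u| := by
  have hcont : Continuous (deriv f) := hf.continuous_deriv le_rfl
  have hint : Integrable (fun p : ℝ × ℝ => |deriv f (p.1 - p.2 * h)|)
      (volume.prod (volume.restrict (Set.Ioc (0 : ℝ) 1))) := by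
    have hc : Continuous (fun p : ℝ × ℝ => |deriv f (p.1 - p.2 * h)|) := by fun_prop
    rw [integrable_prod_iff' hc.aestronglyMeasurable]
    refine ⟨ae_of_all _ fun t => (hf'.comp_sub_right (t * h)).abs, ?_⟩
    have hconst : ∀ t : ℝ, ∫ u : ℝ, ‖|deriv f (u - t * h)|‖ = ∫ u : ℝ, |deriv f u| := by
      intro t
      simp only [Real.norm_eq_abs, abs_abs]
      exact integral_sub_right_eq_self (fun u => |deriv f u|) (t * h)
    simp only [hconst]
    exact integrable_const _
  have hpt : ∀ u : ℝ, |f (u - h) - f u| ≤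
      |h| * ∫ t in Set.Ioc (0 : ℝ) 1, |deriv f (u - t * h)| := by
    intro u
    have hd : ∀ t : ℝ, HasDerivAt (fun t : ℝ => f (u - t * h)) (deriv f (u - t * h) * (-h)) t := by
      intro t
      have h1 : HasDerivAt (fun t : ℝ => u - t * h) (-h) t := by
        simpa using ((hasDerivAt_id t).mul_const h).const_sub u
      exact ((hf.differentiable one_ne_zero) _).hasDerivAt.comp t h1
    have hftc := intervalIntegral.integral_eq_sub_of_hasDerivAt (a := 0) (b := 1)
      (fun t _ => hd t)
      (Continuous.intervalIntegrable (by fun_prop) 0 1)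
    simp only [one_mul, zero_mul, sub_zero] at hftc
    rw [← hftc, intervalIntegral.integral_mul_const, abs_mul, abs_neg, mul_comm,
      intervalIntegral.integral_of_le zero_le_one]
    gcongr
    exact abs_integral_le_integral_abs
  calc ∫ u : ℝ, |f (u - h) - f u|
      ≤ ∫ u : ℝ, |h| * ∫ t in Set.Ioc (0 : ℝ) 1, |deriv f (u - t * h)| :=
        integral_mono_of_nonneg (ae_of_all _ fun _ => abs_nonneg _)
          (hint.integral_prod_left.const_mul _) (ae_of_all _ hpt)
    _ = |h| * ∫ u : ℝ, |deriv f u| := by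
        rw [integral_const_mul, integral_integral_swap hint]
        simp only [fun t : ℝ => integral_sub_right_eq_self (μ := volume)
          (fun u => |deriv f u|) (t * h)]
        simp

theorem monotone_of_subgradient {ρ ψ : ℝ → ℝ}
    (hψ : ∀ u v : ℝ, ρ u + ψ u * (v - u) ≤ ρ v) : Monotone ψ := by
  intro u v huv
  rcases huv.eq_or_lt with rfl | hlt
  · exact le_rfl
  · nlinarith [hψ u v, hψ v u]

theorem abs_subgradient_le {ρ ψ : ℝ → ℝ} {C : ℝ}
    (hρ : ∀ x y : ℝ, |ρ x - ρ y| ≤ C * |x - y|)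
    (hψ : ∀ u v : ℝ, ρ u + ψ u * (v - u) ≤ ρ v) (u : ℝ) : |ψ u| ≤ C := by
  have h1 := hψ u (u + 1)
  have h2 := hψ u (u - 1)
  have h3 := (abs_le.1 (hρ (u + 1) u)).2
  have h4 := (abs_le.1 (hρ (u - 1) u)).2
  simp at h3 h4
  rw [abs_le]
  constructor <;> linarith

theorem hasDerivAt_of_subgradient {ρ ψ : ℝ → ℝ}
    (hψ : ∀ u v : ℝ, ρ u + ψ u * (v - u) ≤ ρ v) {u : ℝ} (hd : DifferentiableAt ℝ ρ u) :
    HasDerivAt ρ (ψ u) u := by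
  have h1 : HasDerivAt (fun v => ρ v - ψ u * (v - u)) (deriv ρ u - ψ u) u := by
    have h2 := hd.hasDerivAt.fun_sub (((hasDerivAt_id' u).sub_const u).const_mul (ψ u))
    rwa [mul_one] at h2
  have hmin : IsLocalMin (fun v => ρ v - ψ u * (v - u)) u :=
    Eventually.of_forall fun v => by
      have := hψ u v
      simp only [sub_self, mul_zero, sub_zero]
      linarith
  have := hmin.hasDerivAt_eq_zero h1
  rw [← sub_eq_zero.1 this]
  exact hd.hasDerivAt

/-- Convolution of a Lipschitz convex function with an integrable kernel may be differentiated
under the integral sign, with any subgradient selection in place of the derivative. -/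
theorem hasDerivAt_integral_mul_kernel {ρ ψ K : ℝ → ℝ} {C : ℝ} (hC : 0 < C)
    (hρ : ∀ x y : ℝ, |ρ x - ρ y| ≤ C * |x - y|)
    (hψ : ∀ u v : ℝ, ρ u + ψ u * (v - u) ≤ ρ v)
    (hK : Integrable K) (hxK : Integrable (fun x => |x| * K x)) (u : ℝ) :
    HasDerivAt (fun u => ∫ x : ℝ, ρ (x + u) * K x) (∫ x : ℝ, ψ (x + u) * K x) u := by
  have hlip : LipschitzWith C.toNNReal ρ :=
    LipschitzWith.of_dist_le_mul fun x y => by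
      simpa [Real.dist_eq, Real.coe_toNNReal C hC.le] using hρ x y
  have hcont : Continuous ρ := hlip.continuous
  have hψm : Measurable ψ := (monotone_of_subgradient hψ).measurable
  refine (hasDerivAt_integral_of_dominated_loc_of_lip (μ := volume) (s := Set.univ)
    (F := fun u x => ρ (x + u) * K x) (F' := fun x => ψ (x + u) * K x)
    (bound := fun x => C * |K x|) univ_mem
    (Eventually.of_forall fun v => ?_) ?_ ?_ ?_ (hK.abs.const_mul C) ?_).2
  · exact (hcont.comp (continuous_add_const v)).aestronglyMeasurable.mul hK.aestronglyMeasurable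
  · refine Integrable.mono' ((hK.abs.const_mul |ρ u|).add (hxK.abs.const_mul C))
      ((hcont.comp (continuous_add_const u)).aestronglyMeasurable.mul hK.aestronglyMeasurable)
      (ae_of_all _ fun x => ?_)
    have h1 : |ρ (x + u)| ≤ |ρ u| + C * |x| := by
      have h2 := hρ (x + u) u
      have h3 := abs_sub_abs_le_abs_sub (ρ (x + u)) (ρ u)
      rw [add_sub_cancel_right] at h2
      linarith
    simp only [Pi.add_apply, norm_mul, Real.norm_eq_abs, abs_mul, abs_abs]
    nlinarith [mul_le_mul_of_nonneg_right h1 (abs_nonneg (K x))]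
  · exact (hψm.comp (measurable_add_const u)).aestronglyMeasurable.mul hK.aestronglyMeasurable
  · refine ae_of_all _ fun x => LipschitzOnWith.of_dist_le_mul fun a _ b _ => ?_
    have h1 := hρ (x + a) (x + b)
    rw [add_sub_add_left_eq_sub] at h1
    rw [Real.dist_eq, Real.dist_eq, ← sub_mul, abs_mul, Real.coe_nnabs, abs_mul, abs_abs,
      abs_of_pos hC]
    nlinarith [mul_le_mul_of_nonneg_right h1 (abs_nonneg (K x))]
  · have hae : ∀ᵐ x : ℝ, DifferentiableAt ℝ ρ (x + u) :=
      (measurePreserving_add_right volume u).quasiMeasurePreserving.ae hlip.ae_differentiableAt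
    filter_upwards [hae] with x hx
    exact ((hasDerivAt_of_subgradient hψ hx).comp_const_add x u).mul_const (K x)

theorem integral_abs_translate_sub_mul_le {ψ f : ℝ → ℝ} {C : ℝ} (hmono : Monotone ψ)
    (hbd : ∀ u, |ψ u| ≤ C) (hfi : Integrable f) (hf : ContDiff ℝ 1 f)
    (hf' : Integrable (deriv f)) (h : ℝ) :
    ∫ u : ℝ, |ψ (h + u) - ψ u| * f u ≤ C * (|h| * ∫ u : ℝ, |deriv f u|) := by
  have hψm : Measurable ψ := hmono.measurable
  have hC : 0 ≤ C := (abs_nonneg _).trans (hbd 0)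
  have hi1 : Integrable (fun u => ψ u * f u) :=
    hfi.bdd_mul hψm.aestronglyMeasurable (ae_of_all _ hbd)
  have hi2 : Integrable (fun u => ψ (h + u) * f u) :=
    hfi.bdd_mul (hψm.comp (measurable_const_add h)).aestronglyMeasurable
      (ae_of_all _ fun u => hbd (h + u))
  have hi3 : Integrable (fun u => ψ u * f (u - h)) :=
    (hfi.comp_sub_right h).bdd_mul hψm.aestronglyMeasurable (ae_of_all _ hbd)
  have hshift : ∫ u : ℝ, ψ (h + u) * f u = ∫ u : ℝ, ψ u * f (u - h) := by
    rw [← integral_add_left_eq_self (fun u => ψ u * f (u - h)) h]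
    simp
  have hdiff : ∫ u : ℝ, (ψ (h + u) - ψ u) * f u = ∫ u : ℝ, ψ u * (f (u - h) - f u) := by
    simp only [sub_mul, mul_sub]
    rw [integral_sub hi2 hi1, integral_sub hi3 hi1, hshift]
  have habs : ∫ u : ℝ, |ψ (h + u) - ψ u| * f u ≤ |∫ u : ℝ, (ψ (h + u) - ψ u) * f u| := by
    rcases le_total 0 h with hh | hh
    · refine le_trans (le_of_eq (integral_congr_ae (ae_of_all _ fun u => ?_))) (le_abs_self _)
      simp only
      rw [abs_of_nonneg (sub_nonneg.2 (hmono (by linarith)))]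
    · refine le_trans (le_of_eq ?_) (neg_le_abs _)
      rw [← integral_neg]
      refine integral_congr_ae (ae_of_all _ fun u => ?_)
      simp only
      rw [abs_of_nonpos (sub_nonpos.2 (hmono (by linarith))), neg_mul]
  calc ∫ u : ℝ, |ψ (h + u) - ψ u| * f u
      ≤ |∫ u : ℝ, ψ u * (f (u - h) - f u)| := hdiff ▸ habs
    _ ≤ ∫ u : ℝ, |ψ u * (f (u - h) - f u)| := abs_integral_le_integral_abs
    _ ≤ ∫ u : ℝ, C * |f (u - h) - f u| := by
        refine integral_mono_of_nonneg (ae_of_all _ fun _ => abs_nonneg _)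
          (((hfi.comp_sub_right h).sub hfi).abs.const_mul C) (ae_of_all _ fun u => ?_)
        simp only [abs_mul]
        gcongr
        exact hbd u
    _ ≤ C * (|h| * ∫ u : ℝ, |deriv f u|) := by
        rw [integral_const_mul]
        gcongr
        exact integral_abs_translate_sub_le hf hf' h

/-- The `L¹(f)` distance between a bounded monotone function and its average against a
probability kernel is controlled by the first absolute moment of the kernel. -/
theorem integral_abs_average_sub_mul_le {ψ f K : ℝ → ℝ} {C : ℝ} (hmono : Monotone ψ)
    (hbd : ∀ u, |ψ u| ≤ C) (hf0 : ∀ u, 0 ≤ f u) (hfi : Integrable f) (hf : ContDiff ℝ 1 f)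
    (hf' : Integrable (deriv f)) (hK0 : ∀ x, 0 ≤ K x) (hK : Integrable K)
    (hK1 : ∫ x : ℝ, K x = 1) (hxK : Integrable (fun x => |x| * K x)) :
    ∫ u : ℝ, |(∫ x : ℝ, ψ (x + u) * K x) - ψ u| * f u
      ≤ C * (∫ x : ℝ, |x| * K x) * ∫ u : ℝ, |deriv f u| := by
  have hψm : Measurable ψ := hmono.measurable
  have hint : Integrable (fun p : ℝ × ℝ => |ψ (p.2 + p.1) - ψ p.1| * (f p.1 * K p.2))
      (volume.prod volume) := by
    refine (hfi.mul_prod hK).bdd_mul (c := C + C)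
      (Measurable.aestronglyMeasurable (by fun_prop)) (ae_of_all _ fun p => ?_)
    rw [Real.norm_eq_abs, abs_abs]
    exact (abs_sub _ _).trans (add_le_add (hbd _) (hbd _))
  have hpt : ∀ u : ℝ, |(∫ x : ℝ, ψ (x + u) * K x) - ψ u| * f u
      ≤ ∫ x : ℝ, |ψ (x + u) - ψ u| * (f u * K x) := by
    intro u
    have hi : Integrable (fun x => ψ (x + u) * K x) :=
      hK.bdd_mul (hψm.comp (measurable_add_const u)).aestronglyMeasurable
        (ae_of_all _ fun x => hbd (x + u))
    have heq : (∫ x : ℝ, ψ (x + u) * K x) - ψ u = ∫ x : ℝ, (ψ (x + u) - ψ u) * K x := by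
      simp only [sub_mul]
      rw [integral_sub hi (hK.const_mul _), integral_const_mul, hK1, mul_one]
    have hle : |(∫ x : ℝ, ψ (x + u) * K x) - ψ u| ≤ ∫ x : ℝ, |ψ (x + u) - ψ u| * K x := by
      rw [heq]
      refine abs_integral_le_integral_abs.trans (le_of_eq ?_)
      simp only [abs_mul, abs_of_nonneg (hK0 _)]
    refine (mul_le_mul_of_nonneg_right hle (hf0 u)).trans (le_of_eq ?_)
    rw [← integral_mul_const]
    congr 1 with x
    ring
  calc ∫ u : ℝ, |(∫ x : ℝ, ψ (x + u) * K x) - ψ u| * f u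
      ≤ ∫ u : ℝ, ∫ x : ℝ, |ψ (x + u) - ψ u| * (f u * K x) :=
        integral_mono_of_nonneg (ae_of_all _ fun u => mul_nonneg (abs_nonneg _) (hf0 u))
          hint.integral_prod_left (ae_of_all _ hpt)
    _ = ∫ x : ℝ, ∫ u : ℝ, |ψ (x + u) - ψ u| * (f u * K x) := integral_integral_swap hint
    _ ≤ ∫ x : ℝ, (C * ∫ u : ℝ, |deriv f u|) * (|x| * K x) := by
        refine integral_mono hint.integral_prod_right (hxK.const_mul _) fun x => ?_
        simp only [← mul_assoc]
        rw [integral_mul_const]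
        refine (mul_le_mul_of_nonneg_right
          (integral_abs_translate_sub_mul_le hmono hbd hfi hf hf' x) (hK0 x)).trans
          (le_of_eq (by ring))
    _ = C * (∫ x : ℝ, |x| * K x) * ∫ u : ℝ, |deriv f u| := by
        rw [integral_const_mul]
        ring

theorem integrable_abs_mul_of_decay {φ : ℝ → ℝ} (hφ : Continuous φ)
    (hdecay : ∀ k : ℕ, ∃ B : ℝ, ∀ x : ℝ, |x| ^ k * |φ x| ≤ B) :
    Integrable (fun x => |x| * φ x) := by
  obtain ⟨B₁, hB₁⟩ := hdecay 1
  obtain ⟨B₃, hB₃⟩ := hdecay 3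
  refine Integrable.mono' (integrable_inv_one_add_sq.const_mul (B₁ + B₃))
    (Continuous.aestronglyMeasurable (by fun_prop)) (ae_of_all _ fun x => ?_)
  rw [← div_eq_mul_inv, le_div_iff₀ (by positivity), norm_mul, Real.norm_eq_abs, Real.norm_eq_abs,
    abs_abs, ← sq_abs x]
  linarith [hB₁ x, hB₃ x, show |x| * |φ x| * (1 + |x| ^ 2) = |x| ^ 1 * |φ x| + |x| ^ 3 * |φ x| by ring]

theorem regSeq_deriv_L1_rate
    (ρ ψ φ f : ℝ → ℝ) (C : ℝ) (hC : 0 < C)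
    (hρconv : ConvexOn ℝ Set.univ ρ)
    (hρlip : ∀ x y : ℝ, |ρ x - ρ y| ≤ C * |x - y|)
    (hψ : ∀ u v : ℝ, ρ u + ψ u * (v - u) ≤ ρ v)
    (hφnonneg : ∀ v, 0 ≤ φ v)
    (hφeven : ∀ v, φ (-v) = φ v)
    (hφsmooth : ContDiff ℝ (⊤ : ℕ∞) φ)
    (hφone : ∫ v : ℝ, φ v = 1)
    (hφdecay : ∀ k n : ℕ, ∃ B : ℝ, ∀ x : ℝ, |x| ^ k * |iteratedDeriv n φ x| ≤ B)
    (hfnonneg : ∀ u, 0 ≤ f u)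
    (hfone : ∫ u : ℝ, f u = 1)
    (hfC1 : ContDiff ℝ 1 f)
    (hf'int : Integrable (deriv f))
    (hρf : Tendsto (fun u : ℝ => ρ u * f u) (cocompact ℝ) (nhds 0))
    (m : ℕ) (hm : 0 < m) :
    ∫ u : ℝ, |deriv (regSeq ρ φ m) u - ψ u| * f u
      ≤ C / (m : ℝ) * (∫ x : ℝ, |x| * φ x) * ∫ u : ℝ, |deriv f u| := by
  have hm' : (0 : ℝ) < m := Nat.cast_pos.2 hm
  have hfi : Integrable f := .of_integral_ne_zero (by simp [hfone])
  have hφi : Integrable φ := .of_integral_ne_zero (by simp [hφone])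
  have hxφ : Integrable (fun x => |x| * φ x) :=
    integrable_abs_mul_of_decay hφsmooth.continuous fun k => by simpa using hφdecay k 0
  set K : ℝ → ℝ := fun x => (m : ℝ) * φ ((m : ℝ) * x) with hKdef
  have hK : Integrable K := (hφi.comp_mul_left' hm'.ne').const_mul _
  have hK0 : ∀ x, 0 ≤ K x := fun x => mul_nonneg hm'.le (hφnonneg _)
  have hK1 : ∫ x : ℝ, K x = 1 := by
    rw [integral_const_mul, Measure.integral_comp_mul_left, hφone, abs_of_pos (inv_pos.2 hm'),
      smul_eq_mul, mul_one, mul_inv_cancel₀ hm'.ne']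
  have hxK_eq : (fun x => |x| * K x) = fun x => |(m : ℝ) * x| * φ ((m : ℝ) * x) := by
    ext x
    rw [abs_mul, abs_of_pos hm']
    ring
  have hxK : Integrable (fun x => |x| * K x) := by
    rw [hxK_eq]
    exact hxφ.comp_mul_left' hm'.ne'
  have hmoment : ∫ x : ℝ, |x| * K x = (m : ℝ)⁻¹ * ∫ x : ℝ, |x| * φ x := by
    rw [hxK_eq, Measure.integral_comp_mul_left (fun x => |x| * φ x), abs_of_pos (inv_pos.2 hm'),
      smul_eq_mul]
  have hreg : regSeq ρ φ m = fun u => ∫ x : ℝ, ρ (x + u) * K x := by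
    ext u
    rw [regSeq, ← integral_add_right_eq_self _ u]
    simp only [add_sub_cancel_right, hKdef]
  have hderiv : ∀ u, deriv (regSeq ρ φ m) u = ∫ x : ℝ, ψ (x + u) * K x := fun u => by
    rw [hreg]
    exact (hasDerivAt_integral_mul_kernel hC hρlip hψ hK hxK u).deriv
  simp only [hderiv]
  refine (integral_abs_average_sub_mul_le (monotone_of_subgradient hψ)
    (abs_subgradient_le hρlip hψ) hfnonneg hfi hfC1 hf'int hK0 hK hK1 hxK).trans (le_of_eq ?_)
  rw [hmoment, div_eq_mul_inv, ← mul_assoc C]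
end

section
/- For every positive integer m and every ε ∈ ℝ, |∫_ℝ [ρ_m″(u + ε) − ρ_m″(u)] f(u) du| ≤ C · (∫_ℝ |f″(u)| du) · (|ε| + (2/m) · ∫_ℝ |x| φ(x) dx). In particular, if e is a random variable with density f, then E[ρ_m″(e + ε) − ρ_m″(e)] = O(m^{−1} + |ε|). -/
open MeasureTheory Filter

/-- An integrable function on `ℝ` can only converge to `0` at `+∞`. -/
lemma eq_zero_of_integrable_of_tendsto_atTop {g : ℝ → ℝ} {L : ℝ} (hg : Integrable g)
    (h : Tendsto g atTop (nhds L)) : L = 0 := by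
  refine IntegrableAtFilter.eq_zero_of_tendsto (hg.integrableAtFilter atTop) ?_ h
  intro s hs
  rcases mem_atTop_sets.1 hs with ⟨b, hb⟩
  rw [← top_le_iff, ← Real.volume_Ici (a := b)]
  exact measure_mono hb

/-- If `f` and `f''` are integrable, then `f'` tends to `0` at `+∞`. -/
lemma tendsto_deriv_atTop_zero {f f' f'' : ℝ → ℝ}
    (hf' : ∀ x, HasDerivAt f (f' x) x) (hf'' : ∀ x, HasDerivAt f' (f'' x) x)
    (hf : Integrable f) (hf''int : Integrable f'') : Tendsto f' atTop (nhds 0) := by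
  have h1 := tendsto_limUnder_of_hasDerivAt_of_integrableOn_Ioi (a := 0)
    (fun x _ => hf'' x) hf''int.integrableOn
  set L := limUnder atTop f'
  have hmvt : ∀ x : ℝ, ∃ c, x < c ∧ f' c = f (x + 1) - f x := by
    intro x
    obtain ⟨c, hc, h⟩ := exists_hasDerivAt_eq_slope f f' (lt_add_one x)
      (fun y _ => (hf' y).continuousAt.continuousWithinAt) (fun y _ => hf' y)
    exact ⟨c, hc.1, by simpa using h⟩
  choose c hc hfc using hmvt
  have h2 : Tendsto (fun x => f (x + 1) - f x) atTop (nhds L) := by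
    have : Tendsto c atTop atTop := tendsto_atTop_mono (fun x => (hc x).le) tendsto_id
    exact (h1.comp this).congr hfc
  rwa [eq_zero_of_integrable_of_tendsto_atTop ((hf.comp_add_right 1).sub hf) h2] at h1

/-- If `f` and `f''` are integrable, then `f` tends to `0` at `+∞`. -/
lemma tendsto_atTop_zero_of_integrable_deriv2 {f f' f'' : ℝ → ℝ}
    (hf' : ∀ x, HasDerivAt f (f' x) x) (hf'' : ∀ x, HasDerivAt f' (f'' x) x)
    (hf : Integrable f) (hf''int : Integrable f'') : Tendsto f atTop (nhds 0) := by
  have h0 := tendsto_deriv_atTop_zero hf' hf'' hf hf''int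
  obtain ⟨a, ha⟩ := eventually_atTop.1 (h0.abs.eventually_le_const (show |(0 : ℝ)| < 1 by simp))
  have hcont : Continuous f' := continuous_iff_continuousAt.2 fun x => (hf'' x).continuousAt
  have hint : IntegrableOn (fun x => f' x * f x) (Set.Ioi a) :=
    hf.integrableOn.bdd_mul hcont.aestronglyMeasurable
      ((ae_restrict_iff' measurableSet_Ioi).2 (ae_of_all _ fun x hx => ha x (le_of_lt hx)))
  have h1 := tendsto_limUnder_of_hasDerivAt_of_integrableOn_Ioi (a := a)
    (f := fun x => f x * f x) (f' := fun x => f' x * f x + f' x * f x)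
    (fun x _ => ((hf' x).mul (hf' x)).congr_deriv (by ring)) (hint.add hint)
  set L := limUnder atTop (fun x => f x * f x)
  have h2 : Tendsto (fun x => |f x|) atTop (nhds (Real.sqrt L)) :=
    ((Real.continuous_sqrt.tendsto L).comp h1).congr fun x => Real.sqrt_mul_self_eq_abs (f x)
  rw [eq_zero_of_integrable_of_tendsto_atTop hf.abs h2] at h2
  exact (tendsto_zero_iff_abs_tendsto_zero f).2 h2

/-- Integrating by parts twice against a function with bounded values and first derivative. -/
lemma integral_deriv2_mul_eq {h h' h'' f f' f'' : ℝ → ℝ} {A B D : ℝ}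
    (hh' : ∀ x, HasDerivAt h (h' x) x) (hh'' : ∀ x, HasDerivAt h' (h'' x) x)
    (hA : ∀ x, |h x| ≤ A) (hB : ∀ x, |h' x| ≤ B) (hD : ∀ x, |h'' x| ≤ D)
    (hf' : ∀ x, HasDerivAt f (f' x) x) (hf'' : ∀ x, HasDerivAt f' (f'' x) x)
    (hf : Integrable f) (hf''int : Integrable f'') :
    ∫ x, h'' x * f x = ∫ x, h x * f'' x := by
  have hcont : Continuous h := continuous_iff_continuousAt.2 fun x => (hh' x).continuousAt
  have hmeas : Measurable h'' := by
    rw [show h'' = deriv h' from funext fun x => (hh'' x).deriv.symm]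
    exact measurable_deriv h'
  have i1 : Integrable (fun x => h'' x * f x) :=
    hf.bdd_mul hmeas.aestronglyMeasurable (ae_of_all _ hD)
  have i2 : Integrable (fun x => h x * f'' x) :=
    hf''int.bdd_mul hcont.aestronglyMeasurable (ae_of_all _ hA)
  have hneg : ∀ (g g' : ℝ → ℝ), (∀ x, HasDerivAt g (g' x) x) →
      ∀ x, HasDerivAt (fun y => g (-y)) (-g' (-x)) x := by
    intro g g' hg x
    exact ((hg (-x)).scomp x (hasDerivAt_neg x)).congr_deriv (by simp)
  have hr1 := hneg f f' hf'
  have hr2 : ∀ x, HasDerivAt (fun y => -f' (-y)) (f'' (-x)) x := fun x =>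
    (hneg f' f'' hf'' x).neg.congr_deriv (neg_neg _)
  have t1 := tendsto_atTop_zero_of_integrable_deriv2 hf' hf'' hf hf''int
  have t2 := tendsto_deriv_atTop_zero hf' hf'' hf hf''int
  have b1 : Tendsto f atBot (nhds 0) := by
    have := (tendsto_atTop_zero_of_integrable_deriv2 hr1 hr2 hf.comp_neg hf''int.comp_neg).comp
      tendsto_neg_atBot_atTop
    simpa [Function.comp_def] using this
  have b2 : Tendsto f' atBot (nhds 0) := by
    have := ((tendsto_deriv_atTop_zero hr1 hr2 hf.comp_neg hf''int.comp_neg).comp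
      tendsto_neg_atBot_atTop).neg
    simpa [Function.comp_def] using this
  have hprod : ∀ (l : Filter ℝ) (g k : ℝ → ℝ) (E : ℝ), (∀ x, |g x| ≤ E) →
      Tendsto k l (nhds 0) → Tendsto (fun x => g x * k x) l (nhds 0) := by
    intro l g k E hE hk
    refine squeeze_zero_norm (a := fun x => E * |k x|) (fun x => ?_) (by simpa using hk.abs.const_mul E)
    rw [norm_mul]
    exact mul_le_mul_of_nonneg_right (hE x) (abs_nonneg _)
  have key := integral_of_hasDerivAt_of_tendsto
    (f := fun x => h' x * f x - h x * f' x) (f' := fun x => h'' x * f x - h x * f'' x)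
    (m := 0 - 0) (n := 0 - 0)
    (fun x => (((hh'' x).mul (hf' x)).sub ((hh' x).mul (hf'' x))).congr_deriv (by ring))
    (i1.sub i2) ((hprod _ _ _ B hB b1).sub (hprod _ _ _ A hA b2))
    ((hprod _ _ _ B hB t1).sub (hprod _ _ _ A hA t2))
  rw [integral_sub i1 i2] at key
  linarith

lemma integrable_one_add_abs_sub_inv_sq (u : ℝ) :
    Integrable (fun x : ℝ => ((1 + |x - u|) ^ 2)⁻¹) := by
  have h := (integrable_one_add_norm (E := ℝ) (μ := volume) (r := 2) (by simp)).comp_sub_right u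
  refine h.congr (ae_of_all _ fun x => ?_)
  have : (0 : ℝ) ≤ 1 + ‖x - u‖ := by positivity
  change (1 + ‖x - u‖) ^ (-(2 : ℝ)) = _
  rw [Real.rpow_neg this, Real.norm_eq_abs]
  norm_cast

/-- Cubic decay of `k` dominates `ρ x * k (x - u)` locally uniformly in `u`, for Lipschitz `ρ`. -/
lemma abs_lipschitz_mul_translate_le {ρ k : ℝ → ℝ} {C B : ℝ} (hC : 0 ≤ C)
    (hρ : ∀ x y : ℝ, |ρ x - ρ y| ≤ C * |x - y|)
    (hB : ∀ x, (1 + |x|) ^ 3 * |k x| ≤ B) {u₀ u : ℝ} (hu : |u - u₀| ≤ 1) (x : ℝ) :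
    |ρ x * k (x - u)| ≤
      ((|ρ u₀| + C) * (8 * B)) * ((1 + |x - u₀|) ^ 2)⁻¹ := by
  have h1 : |ρ x| ≤ (|ρ u₀| + C) * (1 + |x - u₀|) := by
    have a := hρ x u₀
    have b := abs_sub_abs_le_abs_sub (ρ x) (ρ u₀)
    have := mul_nonneg (abs_nonneg (ρ u₀)) (abs_nonneg (x - u₀))
    nlinarith
  have h2 : 1 + |x - u₀| ≤ 2 * (1 + |x - u|) := by
    have := abs_sub_le x u u₀
    have := abs_nonneg (x - u)
    linarith
  have h3 : (1 + |x - u₀|) ^ 3 * |k (x - u)| ≤ 8 * B := by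
    have : (1 + |x - u₀|) ^ 3 ≤ (2 * (1 + |x - u|)) ^ 3 := by gcongr
    have := mul_le_mul_of_nonneg_right this (abs_nonneg (k (x - u)))
    have := hB (x - u)
    nlinarith
  have hpos : 0 < 1 + |x - u₀| := by positivity
  rw [abs_mul, ← div_eq_mul_inv, le_div_iff₀ (by positivity)]
  calc |ρ x| * |k (x - u)| * (1 + |x - u₀|) ^ 2
      ≤ (|ρ u₀| + C) * (1 + |x - u₀|) * |k (x - u)| * (1 + |x - u₀|) ^ 2 := by gcongr
    _ = (|ρ u₀| + C) * ((1 + |x - u₀|) ^ 3 * |k (x - u)|) := by ring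
    _ ≤ (|ρ u₀| + C) * (8 * B) := by gcongr

lemma integrable_lipschitz_mul_translate {ρ k : ℝ → ℝ} {C B : ℝ} (hC : 0 ≤ C)
    (hρ : ∀ x y : ℝ, |ρ x - ρ y| ≤ C * |x - y|) (hρc : Continuous ρ) (hk : Continuous k)
    (hB : ∀ x, (1 + |x|) ^ 3 * |k x| ≤ B) (u : ℝ) :
    Integrable (fun x => ρ x * k (x - u)) :=
  ((integrable_one_add_abs_sub_inv_sq u).const_mul _).mono'
    (by fun_prop : Continuous fun x => ρ x * k (x - u)).aestronglyMeasurable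
    (ae_of_all _ fun x => abs_lipschitz_mul_translate_le hC hρ hB (by simp) x)

lemma hasDerivAt_integral_lipschitz_mul_translate {ρ k k' : ℝ → ℝ} {C B B' : ℝ} (hC : 0 ≤ C)
    (hρ : ∀ x y : ℝ, |ρ x - ρ y| ≤ C * |x - y|) (hρc : Continuous ρ)
    (hk : ∀ x, HasDerivAt k (k' x) x) (hk' : Continuous k')
    (hB : ∀ x, (1 + |x|) ^ 3 * |k x| ≤ B) (hB' : ∀ x, (1 + |x|) ^ 3 * |k' x| ≤ B') (u : ℝ) :
    HasDerivAt (fun u => ∫ x, ρ x * k (x - u)) (-∫ x, ρ x * k' (x - u)) u := by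
  have hkc : Continuous k := continuous_iff_continuousAt.2 fun x => (hk x).continuousAt
  rw [← integral_neg]
  refine (hasDerivAt_integral_of_dominated_loc_of_deriv_le (s := Metric.ball u 1)
    (F' := fun v x => -(ρ x * k' (x - v)))
    (bound := fun x => ((|ρ u| + C) * (8 * B')) * ((1 + |x - u|) ^ 2)⁻¹)
    (Metric.ball_mem_nhds u one_pos)
    (Eventually.of_forall fun v => ?_) ?_ ?_ (ae_of_all _ fun x v hv => ?_) ?_
    (ae_of_all _ fun x v _ => ?_)).2
  · exact (by fun_prop : Continuous fun x => ρ x * k (x - v)).aestronglyMeasurable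
  · exact integrable_lipschitz_mul_translate hC hρ hρc hkc hB u
  · exact (by fun_prop : Continuous fun x => -(ρ x * k' (x - u))).aestronglyMeasurable
  · rw [norm_neg]
    exact abs_lipschitz_mul_translate_le hC hρ hB'
      (by simpa [Real.dist_eq] using (Metric.mem_ball.1 hv).le) x
  · exact (integrable_one_add_abs_sub_inv_sq u).const_mul _
  · have := ((hk (x - v)).scomp v ((hasDerivAt_id v).const_sub x)).const_mul (ρ x)
    simpa [Function.comp_def] using this

/-- Smoothing a `C`-Lipschitz function by `k` gives a `C * ‖k‖₁`-Lipschitz function. -/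
lemma abs_integral_lipschitz_mul_translate_sub_le {ρ k : ℝ → ℝ} {C B : ℝ} (hC : 0 ≤ C)
    (hρ : ∀ x y : ℝ, |ρ x - ρ y| ≤ C * |x - y|) (hρc : Continuous ρ) (hk : Continuous k)
    (hB : ∀ x, (1 + |x|) ^ 3 * |k x| ≤ B) (hki : Integrable k) (u v : ℝ) :
    |(∫ x, ρ x * k (x - u)) - ∫ x, ρ x * k (x - v)| ≤ (C * ∫ x, |k x|) * |u - v| := by
  have e : ∀ w : ℝ, ∫ x, ρ x * k (x - w) = ∫ x, ρ (x + w) * k x := fun w => by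
    simpa using (integral_add_right_eq_self (fun x => ρ x * k (x - w)) w).symm
  have i : ∀ w : ℝ, Integrable fun x => ρ (x + w) * k x := fun w => by
    simpa using (integrable_lipschitz_mul_translate hC hρ hρc hk hB w).comp_add_right w
  rw [e, e, ← integral_sub (i u) (i v)]
  calc |∫ x, (ρ (x + u) * k x - ρ (x + v) * k x)|
      ≤ ∫ x, C * |u - v| * |k x| := by
        rw [← Real.norm_eq_abs]
        refine norm_integral_le_of_norm_le (hki.abs.const_mul _) (ae_of_all _ fun x => ?_)
        rw [← sub_mul, norm_mul]
        have := hρ (x + u) (x + v)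
        rw [add_sub_add_left_eq_sub] at this
        exact mul_le_mul_of_nonneg_right this (abs_nonneg _)
    _ = (C * ∫ x, |k x|) * |u - v| := by rw [integral_const_mul]; ring

lemma integrable_of_cubic_decay {k : ℝ → ℝ} {B : ℝ} (hk : Continuous k)
    (hB : ∀ x, (1 + |x|) ^ 3 * |k x| ≤ B) : Integrable k := by
  simpa using integrable_lipschitz_mul_translate (ρ := fun _ => 1) (C := 0) le_rfl
    (by simp) continuous_const hk hB 0

/-- Polynomial decay is inherited by rescalings `x ↦ c * g (m * x)` with `1 ≤ m`. -/
lemma exists_cubic_decay_comp_mul {g : ℝ → ℝ}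
    (hg : ∀ j : ℕ, ∃ B : ℝ, ∀ x : ℝ, |x| ^ j * |g x| ≤ B) (c : ℝ) {m : ℝ} (hm : 1 ≤ m) :
    ∃ B : ℝ, ∀ x, (1 + |x|) ^ 3 * |c * g (m * x)| ≤ B := by
  obtain ⟨B₀, h₀⟩ := hg 0
  obtain ⟨B₃, h₃⟩ := hg 3
  refine ⟨|c| * (4 * (B₀ + B₃)), fun x => ?_⟩
  have hx : |x| ≤ |m * x| := by
    rw [abs_mul, abs_of_nonneg (zero_le_one.trans hm)]
    exact le_mul_of_one_le_left (abs_nonneg x) hm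
  have h1 : (1 + |x|) ^ 3 ≤ 4 * (1 + |m * x| ^ 3) := by
    have : (1 + |x|) ^ 3 ≤ (1 + |m * x|) ^ 3 := by gcongr
    have hy := abs_nonneg (m * x)
    nlinarith [mul_nonneg (add_nonneg zero_le_one hy) (sq_nonneg (|m * x| - 1))]
  have h0' := h₀ (m * x)
  have h3' := h₃ (m * x)
  rw [pow_zero, one_mul] at h0'
  rw [abs_mul]
  calc (1 + |x|) ^ 3 * (|c| * |g (m * x)|)
      ≤ 4 * (1 + |m * x| ^ 3) * (|c| * |g (m * x)|) := by gcongr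
    _ = |c| * (4 * (|g (m * x)| + |m * x| ^ 3 * |g (m * x)|)) := by ring
    _ ≤ |c| * (4 * (B₀ + B₃)) := by gcongr

theorem regSeq_second_deriv_translation_rate
    (ρ ψ φ f : ℝ → ℝ) (C : ℝ) (hC : 0 < C)
    (hρconv : ConvexOn ℝ Set.univ ρ)
    (hρlip : ∀ x y : ℝ, |ρ x - ρ y| ≤ C * |x - y|)
    (hψ : ∀ u v : ℝ, ρ u + ψ u * (v - u) ≤ ρ v)
    (hφnonneg : ∀ v, 0 ≤ φ v)
    (hφeven : ∀ v, φ (-v) = φ v)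
    (hφsmooth : ContDiff ℝ (⊤ : ℕ∞) φ)
    (hφone : ∫ v : ℝ, φ v = 1)
    (hφdecay : ∀ k n : ℕ, ∃ B : ℝ, ∀ x : ℝ, |x| ^ k * |iteratedDeriv n φ x| ≤ B)
    (hfnonneg : ∀ u, 0 ≤ f u)
    (hfone : ∫ u : ℝ, f u = 1)
    (hfC2 : ContDiff ℝ 2 f)
    (hf''int : Integrable (deriv (deriv f)))
    (hρf : ∀ ε : ℝ, Tendsto (fun u : ℝ => ρ u * f (u - ε)) (cocompact ℝ) (nhds 0))
    (hψf' : ∀ ε : ℝ, Tendsto (fun u : ℝ => ψ u * deriv f (u - ε)) (cocompact ℝ) (nhds 0))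
    (m : ℕ) (hm : 0 < m) :
    ∀ ε : ℝ,
      |∫ u : ℝ, (deriv (deriv (regSeq ρ φ m)) (u + ε) - deriv (deriv (regSeq ρ φ m)) u) * f u|
        ≤ C * (∫ u : ℝ, |deriv (deriv f) u|) * (|ε| + 2 / (m : ℝ) * ∫ x : ℝ, |x| * φ x) := by
  intro ε
  have hm1 : (1 : ℝ) ≤ m := by exact_mod_cast hm
  have hm0 : (0 : ℝ) < m := zero_lt_one.trans_le hm1
  have hρc : Continuous ρ := (LipschitzWith.of_dist_le' hρlip).continuous
  set k₀ : ℝ → ℝ := fun x => m * φ (m * x)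
  set k₁ : ℝ → ℝ := fun x => m ^ 2 * deriv φ (m * x) with hk₁
  set k₂ : ℝ → ℝ := fun x => m ^ 3 * deriv (deriv φ) (m * x) with hk₂
  have hφ1 : ContDiff ℝ (⊤ : ℕ∞) (deriv φ) := (contDiff_infty_iff_deriv.1 hφsmooth).2
  have hφ2 : ContDiff ℝ (⊤ : ℕ∞) (deriv (deriv φ)) := (contDiff_infty_iff_deriv.1 hφ1).2
  have hφd : ∀ x, HasDerivAt φ (deriv φ x) x := fun x =>
    ((contDiff_infty_iff_deriv.1 hφsmooth).1 x).hasDerivAt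
  have hφd' : ∀ x, HasDerivAt (deriv φ) (deriv (deriv φ) x) x := fun x =>
    ((contDiff_infty_iff_deriv.1 hφ1).1 x).hasDerivAt
  have hφ2c := hφ2.continuous
  have hφ1c := hφ1.continuous
  have hφ0c := hφsmooth.continuous
  have c₀ : Continuous k₀ := by fun_prop
  have c₁ : Continuous k₁ := by fun_prop
  have c₂ : Continuous k₂ := by fun_prop
  have d₀ : ∀ x, HasDerivAt k₀ (k₁ x) x := fun x => by
    have := ((hφd (m * x)).scomp x ((hasDerivAt_id x).const_mul (m : ℝ))).const_mul (m : ℝ)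
    exact this.congr_deriv (by simp [hk₁]; ring)
  have d₁ : ∀ x, HasDerivAt k₁ (k₂ x) x := fun x => by
    have := ((hφd' (m * x)).scomp x ((hasDerivAt_id x).const_mul (m : ℝ))).const_mul ((m : ℝ) ^ 2)
    exact this.congr_deriv (by simp [hk₂]; ring)
  obtain ⟨B₀, hB₀⟩ := exists_cubic_decay_comp_mul (g := φ)
    (fun j => by simpa using hφdecay j 0) (m : ℝ) hm1
  obtain ⟨B₁, hB₁⟩ := exists_cubic_decay_comp_mul (g := deriv φ)
    (fun j => by simpa using hφdecay j 1) ((m : ℝ) ^ 2) hm1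
  obtain ⟨B₂, hB₂⟩ := exists_cubic_decay_comp_mul (g := deriv (deriv φ))
    (fun j => by simpa [iteratedDeriv_succ] using hφdecay j 2) ((m : ℝ) ^ 3) hm1
  have k₀int : ∫ x, |k₀ x| = 1 := by
    have : (fun x => |k₀ x|) = fun x => (m : ℝ) * φ (m * x) :=
      funext fun x => abs_of_nonneg (mul_nonneg hm0.le (hφnonneg _))
    rw [this, integral_const_mul, Measure.integral_comp_mul_left, hφone]
    simp [abs_of_pos hm0, hm0.ne']
  set R := regSeq ρ φ m
  set R' : ℝ → ℝ := fun u => -∫ x, ρ x * k₁ (x - u)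
  set R'' : ℝ → ℝ := fun u => ∫ x, ρ x * k₂ (x - u)
  have dR : ∀ u, HasDerivAt R (R' u) u := fun u =>
    hasDerivAt_integral_lipschitz_mul_translate hC.le hρlip hρc d₀ c₁ hB₀ hB₁ u
  have dR' : ∀ u, HasDerivAt R' (R'' u) u := fun u =>
    (hasDerivAt_integral_lipschitz_mul_translate hC.le hρlip hρc d₁ c₂ hB₁ hB₂ u).neg.congr_deriv
      (neg_neg _)
  have lipR : ∀ u v, |R u - R v| ≤ C * |u - v| := fun u v => by
    have := abs_integral_lipschitz_mul_translate_sub_le hC.le hρlip hρc c₀ hB₀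
      (integrable_of_cubic_decay c₀ hB₀) u v
    rwa [k₀int, mul_one] at this
  have lipR' : ∀ u v, |R' u - R' v| ≤ (C * ∫ x, |k₁ x|) * |u - v| := fun u v => by
    have := abs_integral_lipschitz_mul_translate_sub_le hC.le hρlip hρc c₁ hB₁
      (integrable_of_cubic_decay c₁ hB₁) u v
    rwa [abs_sub_comm, ← neg_sub_neg, abs_sub_comm, abs_sub_comm] at this
  set D := C * ∫ x, |k₁ x|
  have hD : 0 ≤ D := mul_nonneg hC.le (integral_nonneg fun x => abs_nonneg _)
  have bR' : ∀ u, |R' u| ≤ C := fun u => by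
    rw [← (dR u).deriv]
    exact norm_deriv_le_of_lip' (f := R) hC.le (Eventually.of_forall fun v => lipR v u)
  have bR'' : ∀ u, |R'' u| ≤ D := fun u => by
    rw [← (dR' u).deriv]
    exact norm_deriv_le_of_lip' (f := R') hD (Eventually.of_forall fun v => lipR' v u)
  have e1 : deriv R = R' := funext fun u => (dR u).deriv
  have e2 : deriv R' = R'' := funext fun u => (dR' u).deriv
  rw [e1, e2]
  have hfd : ∀ x, HasDerivAt f (deriv f x) x := fun x =>
    (hfC2.differentiable (by norm_num) x).hasDerivAt
  have hfd' : ∀ x, HasDerivAt (deriv f) (deriv (deriv f) x) x := fun x =>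
    (hfC2.differentiable_deriv_two x).hasDerivAt
  have hfint : Integrable f := by
    by_contra h
    rw [integral_undef h] at hfone
    exact zero_ne_one hfone
  have hA : ∀ u, |R (u + ε) - R u| ≤ C * |ε| := fun u => by simpa using lipR (u + ε) u
  have h2 := integral_deriv2_mul_eq
    (h := fun u => R (u + ε) - R u) (h' := fun u => R' (u + ε) - R' u)
    (h'' := fun u => R'' (u + ε) - R'' u) (A := C * |ε|) (B := C + C) (D := D + D)
    (fun u => ((dR (u + ε)).comp_add_const u ε).sub (dR u))
    (fun u => ((dR' (u + ε)).comp_add_const u ε).sub (dR' u))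
    hA
    (fun u => (abs_sub _ _).trans (add_le_add (bR' _) (bR' _)))
    (fun u => (abs_sub _ _).trans (add_le_add (bR'' _) (bR'' _)))
    hfd hfd' hfint hf''int
  rw [h2]
  have hI : 0 ≤ ∫ u, |deriv (deriv f) u| := integral_nonneg fun u => abs_nonneg _
  have hJ : 0 ≤ 2 / (m : ℝ) * ∫ x, |x| * φ x :=
    mul_nonneg (by positivity) (integral_nonneg fun x => mul_nonneg (abs_nonneg x) (hφnonneg x))
  calc |∫ u, (R (u + ε) - R u) * deriv (deriv f) u|
      ≤ ∫ u, C * |ε| * |deriv (deriv f) u| := by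
        rw [← Real.norm_eq_abs]
        refine norm_integral_le_of_norm_le (hf''int.abs.const_mul _) (ae_of_all _ fun u => ?_)
        rw [norm_mul]
        exact mul_le_mul_of_nonneg_right (hA u) (abs_nonneg _)
    _ = C * (∫ u, |deriv (deriv f) u|) * |ε| := by rw [integral_const_mul]; ring
    _ ≤ _ := mul_le_mul_of_nonneg_left (le_add_of_nonneg_right hJ) (mul_nonneg hC.le hI)
end
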